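/- In the strong/weak dependency scheduling model, if the graph restricted to strong edges is a DAG and every weak cycle (cycle using at least one weak edge) contains a condition task, then the scheduling algorithm starting from vertices with zero total (strong plus weak) dependencies terminates on every execution in which each condition task eventually selects an exit edge (an edge leaving every cycle it participates in) after finitely many selections. -/

import Mathlib

/-- A (nonempty) directed cycle in the graph with edge relation `R`,
represented as a list of vertices chained by `R` whose last vertex has an
`R`-edge back to its head. -/
def IsCycleList {V : Type*} (R : V → V → Prop) (l : List V) : Prop :=
  ∃ h : l ≠ [], l.Chain' R ∧ R (l.getLast h) (l.head h)

/-- A cycle list uses at least one weak edge `C`. -/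
def CycleUsesWeak {V : Type*} (C : V → V → Prop) (l : List V) : Prop :=
  (∃ p ∈ l.zip l.tail, C p.1 p.2) ∨ ∃ h : l ≠ [], C (l.getLast h) (l.head h)

open Relation in
/-- A walk either follows only `S`-edges or passes through some `C`-edge. -/
theorem transGen_left_or_exists_right {V : Type*} {S C K : V → V → Prop}
    (hK : ∀ a b, K a b → S a b ∨ C a b) {a b : V} (h : TransGen K a b) :
    TransGen S a b ∨ ∃ x y, ReflTransGen K a x ∧ K x y ∧ C x y ∧ ReflTransGen K y b := by
  induction h with
  | single h =>
    rcases hK _ _ h with hs | hc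
    · exact .inl (.single hs)
    · exact .inr ⟨_, _, .refl, h, hc, .refl⟩
  | tail hab h ih =>
    rcases ih with hs | ⟨x, y, hx, hxy, hc, hy⟩
    · rcases hK _ _ h with hs' | hc
      · exact .inl (hs.tail hs')
      · exact .inr ⟨_, _, hab.to_reflTransGen, h, hc, .refl⟩
    · exact .inr ⟨x, y, hx, hxy, hc, hy.tail h⟩

open Relation in
/-- A walk whose vertices all satisfy `p`, as a list of vertices. -/
theorem exists_isChain_forall_of_reflTransGen {V : Type*} {R : V → V → Prop} {p : V → Prop}
    {a b : V} (h : ReflTransGen (fun x y => R x y ∧ p x) a b) (hb : p b) :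
    ∃ l : List V, (a :: l).IsChain R ∧ (a :: l).getLast (List.cons_ne_nil a l) = b ∧
      ∀ c ∈ a :: l, p c := by
  induction h using ReflTransGen.head_induction_on with
  | refl => exact ⟨[], by simp, by simp, by simpa using hb⟩
  | @head x y hxy _ ih =>
    obtain ⟨l, hl, hlast, hp⟩ := ih
    refine ⟨y :: l, List.isChain_cons_cons.2 ⟨hxy.1, hl⟩, by simpa using hlast, ?_⟩
    intro c hc
    rcases List.mem_cons.1 hc with rfl | hc
    · exact hxy.2
    · exact hp c hc

open Relation in
/-- If strong edges are acyclic and every weak cycle contains a condition task, then no closed walk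
avoids the condition tasks. -/
theorem not_transGen_avoiding_cond {V : Type*} {S C : V → V → Prop} {cond : V → Prop}
    (hSacyc : ∀ v, ¬ TransGen S v v)
    (hweakcycle : ∀ l, IsCycleList (fun a b => S a b ∨ C a b) l →
      CycleUsesWeak C l → ∃ c ∈ l, cond c) (v : V) :
    ¬ TransGen (fun a b => (S a b ∨ C a b) ∧ ¬ cond a) v v := by
  intro h
  rcases transGen_left_or_exists_right (S := S) (C := C) (fun _ _ h => h.1) h with
    hs | ⟨x, y, hx, hxy, hc, hy⟩
  · exact hSacyc v hs
  · obtain ⟨l, hl, hlast, hp⟩ :=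
      exists_isChain_forall_of_reflTransGen (p := fun c => ¬ cond c) (hy.trans hx) hxy.2
    obtain ⟨c, hcl, hcc⟩ := hweakcycle (y :: l)
      ⟨List.cons_ne_nil y l, hl, by rw [hlast]; exact hxy.1⟩
      (.inr ⟨List.cons_ne_nil y l, by rw [hlast]; exact hc⟩)
    exact hp c hcl hcc

open Relation in
/-- The edges which are not loop selections of a condition task form a well-founded relation. -/
theorem wellFounded_nonloop_edges {V : Type*} [Finite V] {S C : V → V → Prop} {cond : V → Prop}
    (hSacyc : ∀ v, ¬ TransGen S v v)
    (hweakcycle : ∀ l, IsCycleList (fun a b => S a b ∨ C a b) l →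
      CycleUsesWeak C l → ∃ c ∈ l, cond c) :
    WellFounded (fun u v => (S u v ∨ C u v) ∧
      (cond u → ¬ ReflTransGen (fun a b => S a b ∨ C a b) v u)) := by
  set I : V → V → Prop := fun u v => (S u v ∨ C u v) ∧
    (cond u → ¬ ReflTransGen (fun a b => S a b ∨ C a b) v u)
  have avoid : ∀ {a v}, TransGen I a v → ReflTransGen (fun a b => S a b ∨ C a b) v a →
      TransGen (fun a b => (S a b ∨ C a b) ∧ ¬ cond a) a v := by
    intro a v h
    induction h using TransGen.head_induction_on with
    | single h => exact fun hr => .single ⟨h.1, fun hc => h.2 hc hr⟩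
    | head h hcv ih =>
      intro hr
      have hcv' := (TransGen.mono (fun _ _ h => h.1) _ _ hcv).to_reflTransGen
      exact .head ⟨h.1, fun hc => h.2 hc (hcv'.trans hr)⟩ (ih (hr.tail h.1))
  have : Std.Irrefl (TransGen I) :=
    ⟨fun v h => not_transGen_avoiding_cond hSacyc hweakcycle v (avoid h .refl)⟩
  exact (Finite.wellFounded_of_trans_of_irrefl (TransGen I)).mono fun _ _ h => .single h

/-- Termination of the strong/weak dependency scheduling algorithm.  Over the
dependency relation `R = S ∪ C` (strong edges `S`, weak/condition edges `C`):
if the strong-edge subgraph is acyclic and every cycle using a weak edge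
contains a condition task, then every execution (`exec n` = task executed at
step `n`, `sel n` = the weak successor selected by a condition task executed
at step `n`) in which
* once the scheduler halts it stays halted,
* each source (zero strong and weak in-degree) is executed at most once,
* every execution of a non-source task is triggered by an earlier execution
  of a predecessor (injectively per task, and via the selection if the
  triggering predecessor is a condition task), and
* each condition task performs only finitely many loop selections (selections
  of a successor that can reach the condition task back, i.e., non-exit
  edges),
is finite: the scheduler halts after finitely many steps. -/
theorem stmt_9 {V : Type*} [Finite V] (S C : V → V → Prop) (cond : V → Prop)
    (exec sel : ℕ → Option V) (trig : ℕ → ℕ)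
    (hSacyc : ∀ v, ¬ Relation.TransGen S v v)
    (hweakcycle : ∀ l, IsCycleList (fun a b => S a b ∨ C a b) l →
      CycleUsesWeak C l → ∃ c ∈ l, cond c)
    (hnone : ∀ n, exec n = none → exec (n + 1) = none)
    (hsource : ∀ v, (∀ u, ¬ S u v ∧ ¬ C u v) →
      ∀ m n, exec m = some v → exec n = some v → m = n)
    (htrig : ∀ n v, exec n = some v → (∃ u, S u v ∨ C u v) →
      trig n < n ∧ ∃ u, exec (trig n) = some u ∧ (S u v ∨ C u v) ∧
        (cond u → sel (trig n) = some v))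
    (htriginj : ∀ m n v, exec m = some v → exec n = some v →
      trig m = trig n → m = n)
    (hfinloop : ∀ c, cond c →
      {n | exec n = some c ∧ ∃ v, sel n = some v ∧
        Relation.ReflTransGen (fun a b => S a b ∨ C a b) v c}.Finite) :
    ∃ N, ∀ n, N ≤ n → exec n = none := by
  have finite_exec : ∀ v, {n | exec n = some v}.Finite := by
    intro v
    induction v using (wellFounded_nonloop_edges hSacyc hweakcycle).induction with
    | _ v ih =>
    by_cases hv : ∃ u, S u v ∨ C u v
    · have htrigfin : (⋃ u, {m | exec m = some u ∧ (S u v ∨ C u v) ∧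
          (cond u → sel m = some v)}).Finite := by
        refine Set.finite_iUnion fun u => ?_
        by_cases huv : S u v ∨ C u v
        · by_cases hloop : cond u ∧ Relation.ReflTransGen (fun a b => S a b ∨ C a b) v u
          · exact (hfinloop u hloop.1).subset fun m hm =>
              ⟨hm.1, v, hm.2.2 hloop.1, hloop.2⟩
          · exact (ih u ⟨huv, fun hc hr => hloop ⟨hc, hr⟩⟩).subset fun m hm => hm.1
        · exact Set.finite_empty.subset fun m hm => huv hm.2.1
      refine Set.Finite.of_finite_image (f := trig) (htrigfin.subset ?_)
        fun m hm n hn => htriginj m n v hm hn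
      rintro _ ⟨n, hn, rfl⟩
      exact Set.mem_iUnion.2 (htrig n v hn hv).2
    · refine Set.Subsingleton.finite fun m hm n hn => hsource v (fun u => ?_) m n hm hn
      exact not_or.1 fun h => hv ⟨u, h⟩
  obtain ⟨N, hN⟩ := (Set.finite_iUnion finite_exec).bddAbove
  refine ⟨N + 1, fun n hn => Option.eq_none_iff_forall_ne_some.2 fun v hv => ?_⟩
  have := hN (Set.mem_iUnion.2 ⟨v, hv⟩)
  omega
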